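/- In any coop, a = b/2 if and only if a = a → b; a ≥ b/2 if and only if a ≥ a → b; and a ≤ b/2 if and only if a ≤ a → b. -/

import Mathlib

/-- A pocrim: commutative monoid (z, ad) with residuation operation im,
    ordered by `x ≥ y iff im x y = z`. -/
class Pocrim (M : Type*) where
  z : M
  ad : M → M → M
  im : M → M → M
  ad_assoc : ∀ x y w : M, ad (ad x y) w = ad x (ad y w)
  ad_comm : ∀ x y : M, ad x y = ad y x
  ad_zero : ∀ x : M, ad x z = x
  ge_refl : ∀ x : M, im x x = z
  ge_trans : ∀ x y w : M, im x y = z → im y w = z → im x w = z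
  ge_antisymm : ∀ x y : M, im x y = z → im y x = z → x = y
  ad_mono : ∀ x y w : M, im x y = z → im (ad x w) (ad y w) = z
  ge_zero : ∀ x : M, im x z = z
  resid : ∀ x y w : M, (im (ad x y) w = z ↔ im x (im y w) = z)

namespace Pocrim

variable {M : Type*} [Pocrim M]

/-- `ge x y` means x ≥ y, i.e. x → y = 0. -/
def ge (x y : M) : Prop := im x y = z

end Pocrim

open Pocrim

/-- A hoop is a pocrim satisfying x + (x → y) = y + (y → x). -/
class Hoop (M : Type*) extends Pocrim M where
  cwc : ∀ x y : M, ad x (im x y) = ad y (im y x)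

/-- A coop is a hoop with a halving operation satisfying x/2 = x/2 → x. -/
class Coop (M : Type*) extends Hoop M where
  half : M → M
  half_ax : ∀ x : M, half x = im (half x) x

open Coop

namespace Pocrim

variable {M : Type*} [Pocrim M]

theorem im_ad_ge (x y : M) : ge (ad (im x y) x) y :=
  (resid _ _ _).2 (ge_refl _)

theorem im_ge_im_left {x y : M} (h : ge x y) (w : M) : ge (im y w) (im x w) := by
  refine (resid _ _ _).1 (ge_trans _ _ _ ?_ (im_ad_ge y w))
  rw [ad_comm _ x, ad_comm _ y]
  exact ad_mono _ _ _ h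

theorem im_ge_im_right {u v : M} (h : ge u v) (x : M) : ge (im x u) (im x v) :=
  (resid _ _ _).1 (ge_trans _ _ _ (im_ad_ge x u) h)

theorem ge_im (x y : M) : ge y (im x y) := by
  refine (resid _ _ _).1 ?_
  have h := ad_mono _ _ y (ge_zero x)
  rwa [ad_comm x, ad_comm z, ad_zero] at h

theorem ge_im_comm {x y w : M} : ge x (im y w) ↔ ge y (im x w) := by
  unfold ge
  rw [← resid, ← resid, ad_comm]

theorem im_ad (x y w : M) : im (ad x y) w = im x (im y w) := by
  apply ge_antisymm
  · rw [← resid, ← resid, ad_assoc]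
    exact im_ad_ge _ _
  · rw [← resid, ← ad_assoc, resid]
    exact im_ad_ge _ _

theorem im_left_comm (x y w : M) : im x (im y w) = im y (im x w) := by
  rw [← im_ad, ← im_ad, ad_comm]

end Pocrim

namespace Hoop

variable {M : Type*} [Hoop M]

theorem ad_im_of_ge {x y : M} (h : ge x y) : ad y (im y x) = x := by
  rw [← cwc, show im x y = z from h, ad_zero]

/-- In a hoop, `x → y` can lie below `y → x` only if it vanishes. -/
theorem ge_of_im_ge_im {x y : M} (h : ge (im y x) (im x y)) : ge x y := by
  set d := im x y
  set p := im d y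
  have hxp : ge x p := ge_im_comm.1 (ge_refl d)
  have hpd : ge d (im p y) := ge_im_comm.1 (ge_refl p)
  have hpx : ge (im p x) d := ge_trans _ _ _ (im_ge_im_left (ge_im d y) x) h
  have hsplit : d = im (im p x) (im p y) := by
    rw [← im_ad, ad_comm, ad_im_of_ge hxp]
  have hdz : ge z d := by
    have := im_ge_im_right hpd (im p x)
    rwa [← hsplit, show im (im p x) d = z from hpx] at this
  exact ge_antisymm _ _ (ge_zero _) hdz

end Hoop

theorem coop_halving_bounds {M : Type*} [Coop M] (a b : M) :
    (a = half b ↔ a = im a b) ∧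
    (ge a (half b) ↔ ge a (im a b)) ∧
    (ge (half b) a ↔ ge (im a b) a) := by
  have hb : half b = im (half b) b := half_ax b
  have him : im a (half b) = im (half b) (im a b) := by
    rw [im_left_comm, ← hb]
  have hlower : ge a (half b) ↔ ge a (im a b) := by
    constructor
    · intro h
      have h' := im_ge_im_left h b
      rw [← hb] at h'
      exact ge_trans _ _ _ h h'
    · intro h
      apply Hoop.ge_of_im_ge_im
      rw [him]
      exact im_ge_im_right h _
  have hupper : ge (half b) a ↔ ge (im a b) a := by
    constructor
    · intro h
      have h' := im_ge_im_left h b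
      rw [← hb] at h'
      exact ge_trans _ _ _ h' h
    · intro h
      apply Hoop.ge_of_im_ge_im
      rw [him]
      exact im_ge_im_right h _
  refine ⟨⟨?_, fun h => ?_⟩, hlower, hupper⟩
  · rintro rfl
    exact hb
  · have hrefl : ge a a := ge_refl a
    refine ge_antisymm _ _ (hlower.2 ?_) (hupper.2 ?_) <;> rwa [← h]
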